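/- arXiv:1405.6687 — 7 statements merged into one kernel-verified Lean document; each statement's English description precedes it below -/
import Mathlib

section
/- Suppose W = D⊥ ⊕ Dθ is an orthogonal direct sum of subspaces of W with F(D⊥) ⊆ W⊥, and suppose there is an angle θ such that ‖T Z‖ = cos θ · ‖Z‖ for every Z ∈ Dθ (i.e. Dθ is a slant subspace with slant angle θ). Then T² Z = cos² θ · Z for every Z ∈ Dθ (identity (3.4); one direction of Theorem 3.4, with λ = cos² θ). -/
open RealInnerProductSpace

/-- A linear map that scales norms by a factor `c` on a subspace scales inner products by `c ^ 2`
there. -/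
lemma inner_map_map_eq_sq_mul_of_norm_map_eq
    {V V' : Type*} [NormedAddCommGroup V] [InnerProductSpace ℝ V]
    [NormedAddCommGroup V'] [InnerProductSpace ℝ V']
    (A : V →ₗ[ℝ] V') (D : Submodule ℝ V) (c : ℝ) (h : ∀ x ∈ D, ‖A x‖ = c * ‖x‖)
    {x y : V} (hx : x ∈ D) (hy : y ∈ D) : ⟪A x, A y⟫ = c ^ 2 * ⟪x, y⟫ := by
  have hadd := h (x + y) (D.add_mem hx hy)
  rw [map_add] at hadd
  rw [real_inner_eq_norm_add_mul_self_sub_norm_mul_self_sub_norm_mul_self_div_two,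
    real_inner_eq_norm_add_mul_self_sub_norm_mul_self_sub_norm_mul_self_div_two,
    hadd, h x hx, h y hy]
  ring

/-- The compression to `W` of a symmetric map is symmetric on `W`. -/
lemma inner_compression_left
    {V : Type*} [NormedAddCommGroup V] [InnerProductSpace ℝ V]
    {F P : V → V} {W : Submodule ℝ V} (hF : ∀ u v : V, ⟪F u, v⟫ = ⟪u, F v⟫)
    (hPorth : ∀ v, v - P v ∈ Wᗮ) {u w : V} (hu : u ∈ W) (hw : w ∈ W) :
    ⟪P (F u), w⟫ = ⟪u, P (F w)⟫ := by
  have h₁ := Submodule.inner_left_of_mem_orthogonal hw (hPorth (F u))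
  have h₂ := Submodule.inner_right_of_mem_orthogonal hu (hPorth (F w))
  rw [inner_sub_left] at h₁
  rw [inner_sub_right] at h₂
  linarith [hF u w]

/-- Identity (3.4) / one direction of Theorem 3.4: if `W = D⊥ ⊕ Dθ` is an orthogonal
direct sum with `F(D⊥) ⊆ W⊥` and `Dθ` is slant with slant angle `θ`
(`‖T Z‖ = cos θ · ‖Z‖` for all `Z ∈ Dθ`), then `T² Z = cos² θ • Z` for every `Z ∈ Dθ`. -/
theorem hemi_slant_T_sq_eq_cos_sq_smul
    {V : Type*} [NormedAddCommGroup V] [InnerProductSpace ℝ V]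
    (F : V →ₗ[ℝ] V)
    (hF2 : ∀ v, F (F v) = v)
    (hFinner : ∀ u v : V, ⟪F u, F v⟫ = ⟪u, v⟫)
    (W : Submodule ℝ V)
    (P : V →ₗ[ℝ] V)
    (hPmem : ∀ v, P v ∈ W)
    (hPid : ∀ w ∈ W, P w = w)
    (hPorth : ∀ v, v - P v ∈ Wᗮ)
    (T : V → V) (hT : ∀ u, T u = P (F u))
    (Dperp Dθ : Submodule ℝ V)
    (hsum : Dperp ⊔ Dθ = W)
    (horth : ∀ X ∈ Dperp, ∀ Z ∈ Dθ, ⟪X, Z⟫ = 0)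
    (hanti : ∀ X ∈ Dperp, F X ∈ Wᗮ)
    (θ : ℝ)
    (hslant : ∀ Z ∈ Dθ, ‖T Z‖ = Real.cos θ * ‖Z‖) :
    ∀ Z ∈ Dθ, T (T Z) = (Real.cos θ) ^ 2 • Z := by
  have hFsymm : ∀ u v : V, ⟪F u, v⟫ = ⟪u, F v⟫ := fun u v => by
    rw [← hFinner u (F v), hF2]
  intro Z hZ
  have hZW : Z ∈ W := hsum ▸ Submodule.mem_sup_right hZ
  simp only [hT] at hslant ⊢
  have hPperp : ∀ v ∈ Wᗮ, P v = 0 := fun v hv => by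
    have hPv : P v ∈ Wᗮ := by simpa using Wᗮ.sub_mem hv (hPorth v)
    exact inner_self_eq_zero.mp (Submodule.inner_right_of_mem_orthogonal (hPmem v) hPv)
  have hmem : P (F (P (F Z))) - Real.cos θ ^ 2 • Z ∈ W :=
    W.sub_mem (hPmem _) (W.smul_mem _ hZW)
  have hzero : ∀ w ∈ W, ⟪P (F (P (F Z))) - Real.cos θ ^ 2 • Z, w⟫ = 0 := by
    intro w hw
    rw [inner_sub_left, real_inner_smul_left,
      inner_compression_left hFsymm hPorth (hPmem _) hw]
    rw [← hsum] at hw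
    obtain ⟨X, hX, Y, hY, rfl⟩ := Submodule.mem_sup.mp hw
    have hZY : ⟪P (F Z), P (F Y)⟫ = Real.cos θ ^ 2 * ⟪Z, Y⟫ :=
      inner_map_map_eq_sq_mul_of_norm_map_eq (P ∘ₗ F) Dθ _ hslant hZ hY
    have hZX : ⟪Z, X⟫ = 0 := by rw [real_inner_comm, horth X hX Z hZ]
    rw [map_add, map_add, hPperp _ (hanti X hX), zero_add, inner_add_right, hZX, zero_add,
      hZY, sub_self]
  exact sub_eq_zero.mp (inner_self_eq_zero.mp (hzero _ hmem))
end

section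
/- Let λ ∈ [0,1] and let D ⊆ W be a subspace such that T² U = λ · U for every U ∈ D and T X = 0 for every X ∈ W orthogonal to D. Then F X ∈ W⊥ for every X ∈ W orthogonal to D, and ‖T Z‖ = √λ · ‖Z‖ for every Z ∈ D; hence W decomposes as the orthogonal sum of an anti-invariant subspace and a slant subspace with slant angle θ = arccos √λ (the converse direction of Theorem 3.4). -/
open RealInnerProductSpace

/-- If `v - p` is orthogonal to `W`, then `v` and `p` have the same inner products with the
elements of `W`. -/
theorem real_inner_eq_of_sub_mem_orthogonal
    {V : Type*} [NormedAddCommGroup V] [InnerProductSpace ℝ V] {W : Submodule ℝ V} {v p w : V}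
    (h : v - p ∈ Wᗮ) (hw : w ∈ W) : ⟪v, w⟫ = ⟪p, w⟫ := by
  have := (Submodule.mem_orthogonal' W _).1 h w hw
  rwa [inner_sub_left, sub_eq_zero] at this

/-- The converse direction of Theorem 3.4: if there is `λ ∈ [0,1]` and a subspace
`D ⊆ W` with `T² U = λ • U` on `D` and `T X = 0` for every `X ∈ W` orthogonal to `D`,
then every `X ∈ W` orthogonal to `D` satisfies `F X ∈ W⊥` (so the orthogonal
complement of `D` in `W` is anti-invariant), and `‖T Z‖ = √λ · ‖Z‖` for every
`Z ∈ D` (so `D` is slant with slant angle `θ = arccos √λ`). -/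
theorem hemi_slant_of_T_sq_eq_lambda_smul
    {V : Type*} [NormedAddCommGroup V] [InnerProductSpace ℝ V]
    (F : V →ₗ[ℝ] V)
    (hF2 : ∀ v, F (F v) = v)
    (hFinner : ∀ u v : V, ⟪F u, F v⟫ = ⟪u, v⟫)
    (W : Submodule ℝ V)
    (P : V →ₗ[ℝ] V)
    (hPmem : ∀ v, P v ∈ W)
    (hPid : ∀ w ∈ W, P w = w)
    (hPorth : ∀ v, v - P v ∈ Wᗮ)
    (T : V → V) (hT : ∀ u, T u = P (F u))
    (lam : ℝ) (hlam : lam ∈ Set.Icc (0 : ℝ) 1)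
    (D : Submodule ℝ V) (hDW : D ≤ W)
    (hD : ∀ U ∈ D, T (T U) = lam • U)
    (hD' : ∀ X ∈ W, (∀ d ∈ D, ⟪X, d⟫ = 0) → T X = 0) :
    (∀ X ∈ W, (∀ d ∈ D, ⟪X, d⟫ = 0) → F X ∈ Wᗮ) ∧
    (∀ Z ∈ D, ‖T Z‖ = Real.sqrt lam * ‖Z‖) := by
  refine ⟨fun X hX hXD => ?_, fun Z hZ => ?_⟩
  · have hPF : P (F X) = 0 := by rw [← hT, hD' X hX hXD]
    simpa [hPF] using hPorth (F X)
  · have hTW : T Z ∈ W := hT Z ▸ hPmem (F Z)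
    have hsq : ⟪T Z, T Z⟫ = lam * ⟪Z, Z⟫ := calc
      ⟪T Z, T Z⟫ = ⟪P (F Z), T Z⟫ := by rw [← hT]
      _ = ⟪F Z, T Z⟫ := (real_inner_eq_of_sub_mem_orthogonal (hPorth (F Z)) hTW).symm
      _ = ⟪F (T Z), Z⟫ := by rw [← hFinner, hF2, real_inner_comm]
      _ = ⟪P (F (T Z)), Z⟫ := real_inner_eq_of_sub_mem_orthogonal (hPorth (F (T Z))) (hDW hZ)
      _ = lam * ⟪Z, Z⟫ := by rw [← hT, hD Z hZ, real_inner_smul_left]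
    rw [norm_eq_sqrt_real_inner, norm_eq_sqrt_real_inner, hsq, Real.sqrt_mul hlam.1]
end

section
/- If X, Z ∈ W satisfy ⟪X, Z⟫ = 0 and F X ∈ W⊥, then ⟪F X, N Z⟫ = 0. In particular, in an orthogonal decomposition W = D⊥ ⊕ Dθ with F(D⊥) ⊆ W⊥, the subspaces F(D⊥) and N(Dθ) of the normal space W⊥ are orthogonal to each other (Lemma 3.2). -/
open RealInnerProductSpace

/-- Lemma 3.2: if `X, Z ∈ W` are orthogonal and `F X ∈ W⊥` then `⟪F X, N Z⟫ = 0`.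
In particular, in an orthogonal decomposition `W = D⊥ ⊕ Dθ` with `F(D⊥) ⊆ W⊥`,
the subspaces `F(D⊥)` and `N(Dθ)` of the normal space `W⊥` are orthogonal. -/
theorem hemi_slant_FX_orth_NZ
    {V : Type*} [NormedAddCommGroup V] [InnerProductSpace ℝ V]
    (F : V →ₗ[ℝ] V)
    (hF2 : ∀ v, F (F v) = v)
    (hFinner : ∀ u v : V, ⟪F u, F v⟫ = ⟪u, v⟫)
    (W : Submodule ℝ V)
    (P : V →ₗ[ℝ] V)
    (hPmem : ∀ v, P v ∈ W)
    (hPid : ∀ w ∈ W, P w = w)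
    (hPorth : ∀ v, v - P v ∈ Wᗮ)
    (T : V → V) (hT : ∀ u, T u = P (F u))
    (N : V → V) (hN : ∀ u, N u = F u - T u) :
    ∀ X ∈ W, ∀ Z ∈ W, ⟪X, Z⟫ = 0 → F X ∈ Wᗮ → ⟪F X, N Z⟫ = 0 := by
  intro X _ Z _ hXZ hFX
  rw [hN, inner_sub_right, hFinner, hXZ, hT,
    Submodule.inner_left_of_mem_orthogonal (hPmem (F Z)) hFX, sub_zero]
end

section
/- Suppose W = D⊥ ⊕ Dθ is an orthogonal direct sum with F(D⊥) ⊆ W⊥. Let μ be the orthogonal complement inside W⊥ of the subspace of W⊥ spanned by F(D⊥) and N(Dθ). Then μ is invariant under F, i.e. F(μ) ⊆ μ (the invariance of the subbundle μ in the normal bundle decomposition (3.2)). -/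
open RealInnerProductSpace

/-- The invariance of `μ` in the normal bundle decomposition (3.2): if
`W = D⊥ ⊕ Dθ` is an orthogonal direct sum with `F(D⊥) ⊆ W⊥`, and `μ` is the
orthogonal complement inside `W⊥` of the span of `F(D⊥)` and `N(Dθ)`, then
`F(μ) ⊆ μ`.  Here `N = F - P ∘ F` as a linear map on `V`. -/
theorem hemi_slant_mu_invariant
    {V : Type*} [NormedAddCommGroup V] [InnerProductSpace ℝ V]
    (F : V →ₗ[ℝ] V)
    (hF2 : ∀ v, F (F v) = v)
    (hFinner : ∀ u v : V, ⟪F u, F v⟫ = ⟪u, v⟫)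
    (W : Submodule ℝ V)
    (P : V →ₗ[ℝ] V)
    (hPmem : ∀ v, P v ∈ W)
    (hPid : ∀ w ∈ W, P w = w)
    (hPorth : ∀ v, v - P v ∈ Wᗮ)
    (Dperp Dθ : Submodule ℝ V)
    (hsum : Dperp ⊔ Dθ = W)
    (horth : ∀ X ∈ Dperp, ∀ Z ∈ Dθ, ⟪X, Z⟫ = 0)
    (hanti : ∀ X ∈ Dperp, F X ∈ Wᗮ)
    (μ : Submodule ℝ V)
    (hμ : μ = Wᗮ ⊓ (Dperp.map F ⊔ Dθ.map (F - P ∘ₗ F))ᗮ) :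
    ∀ ξ ∈ μ, F ξ ∈ μ := by
  have hsymm : ∀ u v : V, ⟪F u, v⟫ = ⟪u, F v⟫ := fun u v => by
    rw [← hFinner u (F v), hF2]
  have hmem : ∀ η : V, η ∈ μ ↔ (∀ w ∈ W, ⟪w, η⟫ = 0) ∧
      (∀ X ∈ Dperp, ⟪F X, η⟫ = 0) ∧ ∀ Z ∈ Dθ, ⟪F Z - P (F Z), η⟫ = 0 := by
    intro η
    rw [hμ, ← Submodule.inf_orthogonal]
    simp [Submodule.mem_orthogonal]
  intro ξ hξ
  obtain ⟨hW, hperp, hθ⟩ := (hmem ξ).1 hξ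
  have hFW : ∀ w ∈ W, ⟪w, F ξ⟫ = 0 := by
    intro w hw
    rw [← hsum] at hw
    obtain ⟨X, hX, Z, hZ, rfl⟩ := Submodule.mem_sup.1 hw
    have hFZ := hθ Z hZ
    rw [inner_sub_left, hW _ (hPmem _), sub_zero] at hFZ
    rw [← hsymm, map_add, inner_add_left, hperp X hX, hFZ, add_zero]
  refine (hmem (F ξ)).2 ⟨hFW, fun X hX => ?_, fun Z hZ => ?_⟩
  · rw [hFinner]
    exact hW X (hsum ▸ Submodule.mem_sup_left hX)
  · rw [inner_sub_left, hFinner, hFW _ (hPmem _), sub_zero]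
    exact hW Z (hsum ▸ Submodule.mem_sup_right hZ)
end

section
/- Suppose W = D⊥ ⊕ Dθ is an orthogonal direct sum with F(D⊥) ⊆ W⊥. Then ⟪T u, X⟫ = 0 for every u ∈ W and every X ∈ D⊥; consequently T(W) ⊆ Dθ (the key step in the proof of Lemma 3.3: T Z is orthogonal to the anti-invariant distribution for every tangent vector Z). -/
open RealInnerProductSpace

/-- The key step in the proof of Lemma 3.3: if `W = D⊥ ⊕ Dθ` is an orthogonal
direct sum with `F(D⊥) ⊆ W⊥`, then `⟪T u, X⟫ = 0` for every `u ∈ W` and every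
`X ∈ D⊥`; consequently `T(W) ⊆ Dθ`. -/
theorem hemi_slant_T_orth_Dperp
    {V : Type*} [NormedAddCommGroup V] [InnerProductSpace ℝ V]
    (F : V →ₗ[ℝ] V)
    (hF2 : ∀ v, F (F v) = v)
    (hFinner : ∀ u v : V, ⟪F u, F v⟫ = ⟪u, v⟫)
    (W : Submodule ℝ V)
    (P : V →ₗ[ℝ] V)
    (hPmem : ∀ v, P v ∈ W)
    (hPid : ∀ w ∈ W, P w = w)
    (hPorth : ∀ v, v - P v ∈ Wᗮ)
    (T : V → V) (hT : ∀ u, T u = P (F u))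
    (Dperp Dθ : Submodule ℝ V)
    (hsum : Dperp ⊔ Dθ = W)
    (horth : ∀ X ∈ Dperp, ∀ Z ∈ Dθ, ⟪X, Z⟫ = 0)
    (hanti : ∀ X ∈ Dperp, F X ∈ Wᗮ) :
    (∀ u ∈ W, ∀ X ∈ Dperp, ⟪T u, X⟫ = 0) ∧ (∀ u ∈ W, T u ∈ Dθ) := by
  have hperp : ∀ u ∈ W, ∀ X ∈ Dperp, ⟪T u, X⟫ = 0 := by
    intro u hu X hX
    have hXW : X ∈ W := hsum ▸ Submodule.mem_sup_left hX
    have hnormal : ⟪F u - P (F u), X⟫ = 0 :=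
      Submodule.inner_left_of_mem_orthogonal hXW (hPorth (F u))
    have htangent : ⟪F u, X⟫ = 0 := by
      rw [← hFinner, hF2]
      exact Submodule.inner_right_of_mem_orthogonal hu (hanti X hX)
    rw [inner_sub_left] at hnormal
    rw [hT]
    linarith
  refine ⟨hperp, fun u hu => ?_⟩
  have hTW : T u ∈ Dperp ⊔ Dθ := by
    rw [hsum, hT]
    exact hPmem _
  obtain ⟨X, hX, Z, hZ, hXZ⟩ := Submodule.mem_sup.mp hTW
  have hX0 : X = 0 := by
    have h := hperp u hu X hX
    rwa [← hXZ, inner_add_left, real_inner_comm X Z, horth X hX Z hZ, add_zero,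
      inner_self_eq_zero] at h
  rwa [← hXZ, hX0, zero_add]
end

section
/- Let D ⊆ W be a subspace and θ an angle such that T² Z = cos² θ · Z for every Z ∈ D. Then ⟪N Z, N W'⟫ = sin² θ · ⟪Z, W'⟫ for all Z, W' ∈ D (identity (3.6) for a slant distribution). -/
open RealInnerProductSpace

/-- Identity (3.6) for a slant distribution: if `T² Z = cos² θ • Z` for every
`Z` in a subspace `D ⊆ W`, then `⟪N Z, N W'⟫ = sin² θ · ⟪Z, W'⟫` for all `Z, W' ∈ D`. -/
theorem slant_inner_N_eq_sin_sq
    {V : Type*} [NormedAddCommGroup V] [InnerProductSpace ℝ V]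
    (F : V →ₗ[ℝ] V)
    (hF2 : ∀ v, F (F v) = v)
    (hFinner : ∀ u v : V, ⟪F u, F v⟫ = ⟪u, v⟫)
    (W : Submodule ℝ V)
    (P : V →ₗ[ℝ] V)
    (hPmem : ∀ v, P v ∈ W)
    (hPid : ∀ w ∈ W, P w = w)
    (hPorth : ∀ v, v - P v ∈ Wᗮ)
    (T : V → V) (hT : ∀ u, T u = P (F u))
    (N : V → V) (hN : ∀ u, N u = F u - T u)
    (D : Submodule ℝ V) (hDW : D ≤ W)
    (θ : ℝ)
    (hD : ∀ Z ∈ D, T (T Z) = (Real.cos θ) ^ 2 • Z) :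
    ∀ Z ∈ D, ∀ W' ∈ D, ⟪N Z, N W'⟫ = (Real.sin θ) ^ 2 * ⟪Z, W'⟫ := by
  intro Z hZ Y hY
  have orth : ∀ w ∈ W, ∀ v, ⟪w, v⟫ = ⟪w, P v⟫ := fun w hw v => by
    have h := (Submodule.mem_orthogonal W _).1 (hPorth v) w hw
    rwa [inner_sub_right, sub_eq_zero] at h
  have h₂ : ⟪F Z, T Y⟫ = ⟪T Z, T Y⟫ := by
    rw [real_inner_comm, real_inner_comm (T Y) (T Z), hT Z, hT Y, orth _ (hPmem _) (F Z)]
  have hTT : ⟪T Z, T Y⟫ = Real.cos θ ^ 2 * ⟪Z, Y⟫ :=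
    calc ⟪T Z, T Y⟫ = ⟪F Z, T Y⟫ := h₂.symm
      _ = ⟪Z, F (T Y)⟫ := by rw [← hFinner, hF2]
      _ = ⟪Z, T (T Y)⟫ := by rw [hT (T Y), orth Z (hDW hZ)]
      _ = Real.cos θ ^ 2 * ⟪Z, Y⟫ := by rw [hD Y hY, real_inner_smul_right]
  have h₁ : ⟪T Z, F Y⟫ = ⟪T Z, T Y⟫ := by
    rw [hT Z, hT Y, orth _ (hPmem _)]
  rw [hN, hN, inner_sub_left, inner_sub_right, inner_sub_right, hFinner, h₁, h₂, hTT,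
    Real.sin_sq]
  ring
end

section
/- Let {e₁, e₂, …, e_m} be an orthonormal basis of M and write V₀ = e₁. Then Σ_{i=2}^m ⟪R̄(V₀, e_i) e_i, V₀⟫ = ¼(c₁+c₂)·[(m−1) + (Σ_{i=2}^m ⟪T e_i, e_i⟫)·⟪T V₀, V₀⟫ − ‖T V₀‖² + ⟪T V₀, V₀⟫²] + ¼(c₁−c₂)·[Σ_{i=2}^m ⟪T e_i, e_i⟫ + (m−1)·⟪T V₀, V₀⟫] (the computation of the ambient Ricci curvature R̄ic_{T_pM}(V₀), equation (8.6), with the last term of the (c₁+c₂)-bracket being the square ⟪T V₀, V₀⟫²). -/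
open RealInnerProductSpace

/-- The curvature tensor (7.4) of the locally product Riemannian manifold
`M₁(c₁) × M₂(c₂)`. -/
noncomputable def lpRCurv {V : Type*} [NormedAddCommGroup V] [InnerProductSpace ℝ V]
    (F : V →ₗ[ℝ] V) (c₁ c₂ : ℝ) (U V' W' : V) : V :=
  ((c₁ + c₂) / 4) •
      (⟪V', W'⟫ • U - ⟪U, W'⟫ • V' + ⟪F V', W'⟫ • F U - ⟪F U, W'⟫ • F V') +
    ((c₁ - c₂) / 4) •
      (⟪F V', W'⟫ • U - ⟪F U, W'⟫ • V' + ⟪V', W'⟫ • F U - ⟪U, W'⟫ • F V')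

/-- Parseval's identity for a vector in the span of a finite orthonormal family. -/
theorem Orthonormal.sum_inner_sq_eq_norm_sq_of_mem_span {V ι : Type*} [NormedAddCommGroup V]
    [InnerProductSpace ℝ V] [Fintype ι] {e : ι → V} (he : Orthonormal ℝ e) {w : V}
    (hw : w ∈ Submodule.span ℝ (Set.range e)) : ∑ i, ⟪w, e i⟫ ^ 2 = ‖w‖ ^ 2 := by
  obtain ⟨c, rfl⟩ := (Submodule.mem_span_range_iff_exists_fun ℝ).1 hw
  rw [← real_inner_self_eq_norm_sq, he.inner_sum]
  refine Finset.sum_congr rfl fun i _ => ?_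
  rw [he.inner_left_fintype]
  simp [sq]

/-- The sectional term `⟪R̄(U, W) W, U⟫` for an orthonormal pair `U, W` and symmetric `F`. -/
theorem inner_lpRCurv_self {V : Type*} [NormedAddCommGroup V] [InnerProductSpace ℝ V]
    {F : V →ₗ[ℝ] V} (hF : F.IsSymmetric) (c₁ c₂ : ℝ) {U W : V}
    (hU : ‖U‖ = 1) (hW : ‖W‖ = 1) (hUW : ⟪U, W⟫ = 0) :
    ⟪lpRCurv F c₁ c₂ U W W, U⟫ =
      ((c₁ + c₂) / 4) * (1 + ⟪F W, W⟫ * ⟪F U, U⟫ - ⟪F U, W⟫ ^ 2) +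
        ((c₁ - c₂) / 4) * (⟪F W, W⟫ + ⟪F U, U⟫) := by
  have hWU : ⟪W, U⟫ = 0 := by rw [real_inner_comm, hUW]
  have hFWU : ⟪F W, U⟫ = ⟪F U, W⟫ := by rw [hF W U, real_inner_comm]
  simp only [lpRCurv, inner_add_left, inner_sub_left, real_inner_smul_left,
    real_inner_self_eq_norm_sq, hU, hW, hUW, hWU, hFWU]
  ring

/-- Equation (8.6): the computation of the ambient Ricci curvature
`R̄ic_{T_pM}(V₀)` of a submanifold tangent space `M` of
`M̄ = M₁(c₁) × M₂(c₂)`, for an orthonormal basis `{e₁ = V₀, e₂, …, e_m}` of `M`. -/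
theorem lpR_ambient_ricci
    {V : Type*} [NormedAddCommGroup V] [InnerProductSpace ℝ V] [FiniteDimensional ℝ V]
    (F : V →ₗ[ℝ] V)
    (hF2 : ∀ v, F (F v) = v)
    (hFinner : ∀ u v : V, ⟪F u, F v⟫ = ⟪u, v⟫)
    (c₁ c₂ : ℝ)
    (M : Submodule ℝ V) (m : ℕ) (hm : 0 < m)
    (hdim : Module.finrank ℝ M = m)
    (P : V →ₗ[ℝ] V)
    (hPmem : ∀ v, P v ∈ M)
    (hPid : ∀ w ∈ M, P w = w)
    (hPorth : ∀ v, v - P v ∈ Mᗮ)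
    (T : V → V) (hT : ∀ u, T u = P (F u))
    (e : Fin m → V)
    (he : Orthonormal ℝ e)
    (hmem : ∀ i, e i ∈ M)
    (hspan : Submodule.span ℝ (Set.range e) = M)
    (V₀ : V) (hV₀ : V₀ = e ⟨0, hm⟩) :
    ∑ i ∈ Finset.univ.filter (fun i : Fin m => i ≠ ⟨0, hm⟩),
        ⟪lpRCurv F c₁ c₂ V₀ (e i) (e i), V₀⟫ =
      ((c₁ + c₂) / 4) *
          (((m : ℝ) - 1) +
            (∑ i ∈ Finset.univ.filter (fun i : Fin m => i ≠ ⟨0, hm⟩), ⟪T (e i), e i⟫) *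
              ⟪T V₀, V₀⟫ -
            ‖T V₀‖ ^ 2 + ⟪T V₀, V₀⟫ ^ 2) +
        ((c₁ - c₂) / 4) *
          ((∑ i ∈ Finset.univ.filter (fun i : Fin m => i ≠ ⟨0, hm⟩), ⟪T (e i), e i⟫) +
            ((m : ℝ) - 1) * ⟪T V₀, V₀⟫) := by
  have hF : F.IsSymmetric := fun u v => by rw [← hFinner u (F v), hF2]
  have hTinner : ∀ u, ∀ w ∈ M, ⟪T u, w⟫ = ⟪F u, w⟫ := fun u w hw => by
    have h := Submodule.inner_left_of_mem_orthogonal hw (hPorth (F u))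
    rw [inner_sub_left] at h
    rw [hT]
    linarith
  subst hV₀
  set o : Fin m := ⟨0, hm⟩
  have hparseval : ∑ i, ⟪T (e o), e i⟫ ^ 2 = ‖T (e o)‖ ^ 2 :=
    he.sum_inner_sq_eq_norm_sq_of_mem_span (by rw [hspan, hT]; exact hPmem _)
  rw [Finset.filter_ne']
  have hcard : ((Finset.univ.erase o).card : ℝ) = (m : ℝ) - 1 := by
    rw [Finset.cast_card_erase_of_mem (Finset.mem_univ o), Finset.card_univ, Fintype.card_fin]
  rw [← Finset.add_sum_erase _ _ (Finset.mem_univ o)] at hparseval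
  rw [← hparseval, ← hcard]
  have hterm : ∀ i ∈ Finset.univ.erase o, ⟪lpRCurv F c₁ c₂ (e o) (e i) (e i), e o⟫ =
      ((c₁ + c₂) / 4) * (1 + ⟪T (e i), e i⟫ * ⟪T (e o), e o⟫ - ⟪T (e o), e i⟫ ^ 2) +
        ((c₁ - c₂) / 4) * (⟪T (e i), e i⟫ + ⟪T (e o), e o⟫) := fun i hi => by
    simp only [hTinner _ _ (hmem _)]
    exact inner_lpRCurv_self hF c₁ c₂ (he.1 o) (he.1 i) (he.2 (Finset.ne_of_mem_erase hi).symm)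
  rw [Finset.sum_congr rfl hterm]
  simp only [Finset.sum_add_distrib, Finset.sum_sub_distrib, ← Finset.mul_sum, ← Finset.sum_mul,
    Finset.sum_const, nsmul_eq_mul]
  ring
end
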